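/- Let p > 2. There exist constants C > 0 and δ ∈ (0,1) such that L(z) ≤ C·|log z| for every z ∈ (0, δ). -/

import Mathlib

open MeasureTheory

/-- `f(t) = t²/2 - tᵖ/p`. -/
noncomputable def f (p t : ℝ) : ℝ := t ^ 2 / 2 - t ^ p / p

/-- For `p > 2`, the function `f p` is concave on `[1, ∞)`. -/
theorem concaveOn_f {p : ℝ} (hp : 2 < p) : ConcaveOn ℝ (Set.Ici 1) (f p) := by
  have hd : ∀ t : ℝ, HasDerivAt (f p) (t - t ^ (p - 1)) t := by
    intro t
    have h1 : HasDerivAt (fun t : ℝ => t ^ 2 / 2) t t := by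
      simpa using (hasDerivAt_pow 2 t).div_const 2
    have h2 : HasDerivAt (fun t : ℝ => t ^ p / p) (t ^ (p - 1)) t := by
      have h := (Real.hasDerivAt_rpow_const (x := t) (p := p) (Or.inr (by linarith))).div_const p
      rwa [mul_div_cancel_left₀ _ (by linarith : (0 : ℝ) < p).ne'] at h
    exact h1.sub h2
  refine AntitoneOn.concaveOn_of_deriv (convex_Ici 1)
    (fun t _ => (hd t).continuousAt.continuousWithinAt)
    (fun t _ => (hd t).differentiableAt.differentiableWithinAt) ?_
  intro x hx y hy hxy
  rw [interior_Ici, Set.mem_Ioi] at hx hy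
  rw [(hd x).deriv, (hd y).deriv]
  have key : ∀ t : ℝ, 1 < t → t ^ (p - 1) = t * t ^ (p - 2) := by
    intro t ht
    rw [show p - 1 = 1 + (p - 2) by ring, Real.rpow_add (by linarith), Real.rpow_one]
  rw [key x hx, key y hy]
  have h1 : 1 ≤ x ^ (p - 2) := Real.one_le_rpow hx.le (by linarith)
  have h2 : x ^ (p - 2) ≤ y ^ (p - 2) :=
    Real.rpow_le_rpow (by linarith) hxy (by linarith)
  nlinarith

theorem f_one (p : ℝ) : f p 1 = 1 / 2 - 1 / p := by simp [f]

theorem f_one_pos {p : ℝ} (hp : 2 < p) : 0 < f p 1 := by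
  rw [f_one, sub_pos]
  exact one_div_lt_one_div_of_lt (by norm_num) hp

/-- On `(0, 1]` the function `f p` dominates a multiple of the square. -/
theorem f_one_mul_sq_le {p t : ℝ} (hp : 2 < p) (ht : 0 < t) (ht1 : t ≤ 1) :
    f p 1 * t ^ 2 ≤ f p t := by
  have h : t ^ p ≤ t ^ 2 := by
    rw [← Real.rpow_two]
    exact Real.rpow_le_rpow_of_exponent_ge ht ht1 hp.le
  have h' : t ^ p / p ≤ t ^ 2 / p := by gcongr
  rw [f_one]
  calc (1 / 2 - 1 / p) * t ^ 2 = t ^ 2 / 2 - t ^ 2 / p := by ring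
    _ ≤ f p t := by unfold f; linarith

/-- A lower bound on `f p` at a point of `[1, ∞)` bounds the point. -/
theorem le_of_neg_le_f {p w : ℝ} (hp : 2 < p) (hw : 1 ≤ w) (h : -(3 / 2) ≤ f p w) :
    w ≤ (2 * p) ^ (1 / (p - 2)) := by
  have hq : 0 < p - 2 := by linarith
  have hw0 : 0 < w := by linarith
  rw [one_div, Real.le_rpow_inv_iff_of_pos hw0.le (by linarith) hq]
  have hpow : w ^ p = w ^ 2 * w ^ (p - 2) := by
    rw [← Real.rpow_two, ← Real.rpow_add hw0]; ring_nf
  have h2 : w ^ p / p ≤ 2 * w ^ 2 := by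
    unfold f at h
    nlinarith
  rw [div_le_iff₀ (by linarith), hpow] at h2
  have : 0 < w ^ 2 := by positivity
  nlinarith

/-- The integrand of the length function is dominated by a sum of two elementary functions, one
for each endpoint. -/
theorem one_div_sqrt_le {p z t w : ℝ} (hp : 2 < p) (hz : 0 < z) (hz1 : z ≤ 1)
    (hfw : f p w = -3 * f p z) (hzt : z < t) (htw : t ≤ w) :
    1 / √(f p t + 3 * f p z) ≤
      1 / √(f p 1) * t⁻¹ + √(w - 1) / √(f p 1) * (w - t) ^ (-(1 / 2) : ℝ) := by
  have hc := f_one_pos hp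
  have ht : 0 < t := hz.trans hzt
  have hfz : 0 ≤ f p z := le_trans (by positivity) (f_one_mul_sq_le hp hz hz1)
  have hwt : 0 ≤ w - t := by linarith
  have hs1 : 0 ≤ 1 / √(f p 1) * t⁻¹ := by positivity
  have hs2 : 0 ≤ √(w - 1) / √(f p 1) * (w - t) ^ (-(1 / 2) : ℝ) := by positivity
  rcases le_or_gt t 1 with h1 | h1
  · have hle : √(f p 1) * t ≤ √(f p t + 3 * f p z) := by
      apply Real.le_sqrt_of_sq_le
      rw [mul_pow, Real.sq_sqrt hc.le]
      linarith [f_one_mul_sq_le hp ht h1]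
    have : 1 / √(f p t + 3 * f p z) ≤ 1 / (√(f p 1) * t) :=
      one_div_le_one_div_of_le (by positivity) hle
    calc _ ≤ 1 / (√(f p 1) * t) := this
      _ = 1 / √(f p 1) * t⁻¹ := by rw [one_div, one_div, mul_inv]
      _ ≤ _ := by linarith
  rcases htw.eq_or_lt with rfl | htw
  · rw [hfw]
    simpa using add_nonneg hs1 hs2
  · have hw1 : 0 < w - 1 := by linarith
    have hwt : 0 < w - t := by linarith
    have hconc := (concaveOn_f hp).2 (show (1 : ℝ) ∈ Set.Ici 1 by simp)
      (show w ∈ Set.Ici 1 by simp; linarith)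
      (show 0 ≤ (w - t) / (w - 1) by positivity)
      (show 0 ≤ (t - 1) / (w - 1) from div_nonneg (by linarith) hw1.le) (by field_simp; ring)
    have hcomb : ((w - t) / (w - 1)) • (1 : ℝ) + ((t - 1) / (w - 1)) • w = t := by
      simp only [smul_eq_mul]; field_simp; ring
    rw [hcomb, smul_eq_mul, smul_eq_mul, hfw] at hconc
    have hle1 : (t - 1) / (w - 1) ≤ 1 := by rw [div_le_one hw1]; linarith
    have hle : f p 1 * (w - t) / (w - 1) ≤ f p t + 3 * f p z := by
      have : f p 1 * (w - t) / (w - 1) = (w - t) / (w - 1) * f p 1 := by ring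
      nlinarith
    calc _ ≤ 1 / √(f p 1 * (w - t) / (w - 1)) :=
          one_div_le_one_div_of_le (by positivity) (Real.sqrt_le_sqrt hle)
      _ = √(w - 1) / √(f p 1) * (w - t) ^ (-(1 / 2) : ℝ) := by
          rw [Real.sqrt_div (by positivity), Real.sqrt_mul hc.le, Real.rpow_neg hwt.le,
            ← Real.sqrt_eq_rpow]
          field_simp
      _ ≤ _ := by linarith

theorem intervalIntegrable_sub_rpow_neg_half (z w : ℝ) :
    IntervalIntegrable (fun t => (w - t) ^ (-(1 / 2) : ℝ)) volume z w := by
  have h := (intervalIntegral.intervalIntegrable_rpow' (a := w - z) (b := 0)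
    (r := -(1 / 2)) (by norm_num)).comp_sub_left w
  simpa using h

theorem integral_sub_rpow_neg_half (z w : ℝ) :
    ∫ t in z..w, (w - t) ^ (-(1 / 2) : ℝ) = 2 * √(w - z) := by
  rw [intervalIntegral.integral_comp_sub_left (fun t => t ^ (-(1 / 2) : ℝ)) w,
    integral_rpow (Or.inl (by norm_num)), Real.sqrt_eq_rpow]
  norm_num
  ring

/-- A bound on the length integral, with explicit dependence on the endpoints. -/
theorem integral_one_div_sqrt_le {p z w : ℝ} (hp : 2 < p) (hz : 0 < z) (hz1 : z ≤ 1)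
    (hw : 1 ≤ w) (hfw : f p w = -3 * f p z) :
    ∫ t in z..w, 1 / √(f p t + 3 * f p z) ≤ (3 * w - Real.log z) / √(f p 1) := by
  have hzw : z ≤ w := hz1.trans hw
  have hi1 : IntervalIntegrable (fun t : ℝ => 1 / √(f p 1) * t⁻¹) volume z w :=
    (intervalIntegrable_inv_iff.2 (Or.inr (by
      rw [Set.uIcc_of_le hzw]; exact fun h => absurd h.1 (not_le.2 hz)))).const_mul _
  have hi2 := (intervalIntegrable_sub_rpow_neg_half z w).const_mul (√(w - 1) / √(f p 1))
  have hmono : ∫ t in z..w, 1 / √(f p t + 3 * f p z) ≤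
      ∫ t in z..w, (1 / √(f p 1) * t⁻¹ +
        √(w - 1) / √(f p 1) * (w - t) ^ (-(1 / 2) : ℝ)) := by
    rw [intervalIntegral.integral_of_le hzw, intervalIntegral.integral_of_le hzw]
    refine integral_mono_of_nonneg (Filter.Eventually.of_forall fun t => by positivity)
      ((intervalIntegrable_iff_integrableOn_Ioc_of_le hzw).1 (hi1.add hi2)) ?_
    refine (ae_restrict_iff' measurableSet_Ioc).2 (Filter.Eventually.of_forall fun t ht => ?_)
    exact one_div_sqrt_le hp hz hz1 hfw ht.1 ht.2
  have hw0 : 0 < w := by linarith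
  have hlog : Real.log w ≤ w := (Real.log_le_sub_one_of_pos hw0).trans (by linarith)
  have hsq : √(w - 1) * √(w - z) ≤ w :=
    calc √(w - 1) * √(w - z) ≤ √w * √w := by gcongr <;> linarith
      _ = w := Real.mul_self_sqrt hw0.le
  refine hmono.trans ?_
  rw [intervalIntegral.integral_add hi1 hi2, intervalIntegral.integral_const_mul,
    intervalIntegral.integral_const_mul, integral_inv_of_pos hz hw0,
    integral_sub_rpow_neg_half z w, Real.log_div hw0.ne' hz.ne']
  calc _ = (Real.log w - Real.log z + 2 * (√(w - 1) * √(w - z))) / √(f p 1) := by ring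
    _ ≤ _ := by gcongr; linarith

/-- for `p > 2` there exist `C > 0` and `δ ∈ (0,1)` such that the length
function `L(z) = (1/√2) ∫_z^{w(z)} dt/√(f(t)+3f(z))` satisfies `L(z) ≤ C |log z|` for
every `z ∈ (0,δ)`. -/
theorem stmt_18 (p : ℝ) (hp : 2 < p) (w : ℝ → ℝ)
    (hw : ∀ z ∈ Set.Ioc (0 : ℝ) ((p / 2) ^ (1 / (p - 2))),
      1 ≤ w z ∧ f p (w z) = -3 * f p z)
    (L : ℝ → ℝ)
    (hL : ∀ z ∈ Set.Ioc (0 : ℝ) ((p / 2) ^ (1 / (p - 2))),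
      L z = (1 / Real.sqrt 2) * ∫ t in z..(w z), 1 / Real.sqrt (f p t + 3 * f p z)) :
    ∃ C > (0 : ℝ), ∃ δ ∈ Set.Ioo (0 : ℝ) 1,
      ∀ z ∈ Set.Ioo (0 : ℝ) δ, L z ≤ C * |Real.log z| := by
  set M : ℝ := (2 * p) ^ (1 / (p - 2))
  have hM0 : 0 < M := Real.rpow_pos_of_pos (by linarith) _
  have hc := f_one_pos hp
  refine ⟨(3 * M + 1) / √(f p 1), by positivity, Real.exp (-1),
    ⟨Real.exp_pos _, by simp⟩, fun z ⟨hz, hzδ⟩ => ?_⟩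
  have hlog : Real.log z < -1 := (Real.log_lt_iff_lt_exp hz).2 hzδ
  have hz1 : z ≤ 1 := hzδ.le.trans (by simp)
  have hT : 1 ≤ (p / 2) ^ (1 / (p - 2)) :=
    Real.one_le_rpow (by linarith) (div_nonneg zero_le_one (by linarith))
  have hzT : z ∈ Set.Ioc (0 : ℝ) ((p / 2) ^ (1 / (p - 2))) := ⟨hz, hz1.trans hT⟩
  obtain ⟨hw1, hfw⟩ := hw z hzT
  have hwM : w z ≤ M := by
    refine le_of_neg_le_f hp hw1 ?_
    have h : 0 ≤ z ^ p / p := div_nonneg (Real.rpow_nonneg hz.le p) (by linarith)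
    rw [hfw, f]
    nlinarith
  have hI := integral_one_div_sqrt_le hp hz hz1 hw1 hfw
  have hI0 : 0 ≤ (3 * w z - Real.log z) / √(f p 1) := div_nonneg (by linarith) (by positivity)
  have hsqrt : 1 / √2 ≤ (1 : ℝ) := by
    rw [div_le_one (by positivity)]
    exact Real.one_le_sqrt.2 (by norm_num)
  rw [hL z hzT, abs_of_neg (by linarith)]
  calc _ ≤ 1 / √2 * ((3 * w z - Real.log z) / √(f p 1)) := by gcongr
    _ ≤ (3 * w z - Real.log z) / √(f p 1) := mul_le_of_le_one_left hI0 hsqrt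
    _ ≤ (3 * M + 1) * -Real.log z / √(f p 1) := by
        gcongr
        nlinarith
    _ = _ := by ring
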